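/- Let 1 ≤ s ≤ t ≤ r be integers. Then there exists an (r,t)-graph H with τ_s(H) ≥ ⌊(r−t)/2⌋ + s. -/

import Mathlib

/-- `E` is the edge set of an `r`-uniform `r`-partite hypergraph on vertex type `V`
with parts given by the fibres of `part`: each edge contains exactly one vertex
from each of the `r` parts. -/
def IsRPartite {V : Type} (r : ℕ) (part : V → Fin r) (E : Finset (Finset V)) : Prop :=
  ∀ e ∈ E, ∀ j : Fin r, (e.filter (fun v => part v = j)).card = 1

/-- The hypergraph with edge set `E` is `t`-intersecting. -/
def IntersectingGe {V : Type} (t : ℕ) (E : Finset (Finset V)) : Prop :=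
  ∀ e ∈ E, ∀ f ∈ E, t ≤ ((↑e ∩ ↑f : Set V)).ncard

/-- `C` is a vertex cover of the hypergraph with edge set `E`. -/
def IsCover {V : Type} (E : Finset (Finset V)) (C : Finset V) : Prop :=
  ∀ e ∈ E, ∃ v ∈ e, v ∈ C

/-- The cover number: the minimum size of a vertex cover. -/
noncomputable def coverNumber {V : Type} (E : Finset (Finset V)) : ℕ :=
  sInf {n | ∃ C : Finset V, IsCover E C ∧ C.card = n}

/-- `B` is an `s`-cover of the hypergraph with edge set `E`: it meets every edge
in at least `s` vertices. -/
def IsSCover {V : Type} (s : ℕ) (E : Finset (Finset V)) (B : Finset V) : Prop :=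
  ∀ e ∈ E, s ≤ ((↑e ∩ ↑B : Set V)).ncard

/-- The `s`-cover number: the minimum size of an `s`-cover. -/
noncomputable def sCoverNumber {V : Type} (s : ℕ) (E : Finset (Finset V)) : ℕ :=
  sInf {n | ∃ B : Finset V, IsSCover s E B ∧ B.card = n}

/-- The graph of `f` as a set of vertices of the complete partite hypergraph on `α × β`. -/
def graphEdge {α β : Type} [Fintype α] (f : α → β) : Finset (α × β) :=
  Finset.univ.map ⟨fun i => (i, f i), fun _ _ h => congrArg Prod.fst h⟩

theorem mem_graphEdge {α β : Type} [Fintype α] {f : α → β} {v : α × β} :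
    v ∈ graphEdge f ↔ f v.1 = v.2 := by
  simp only [graphEdge, Finset.mem_map, Finset.mem_univ, true_and]
  constructor
  · rintro ⟨i, rfl⟩
    rfl
  · intro h
    exact ⟨v.1, Prod.ext rfl h⟩

theorem ncard_graphEdge_inter {α β : Type} [Fintype α] [DecidableEq α] [DecidableEq β]
    (f : α → β) (B : Finset (α × β)) :
    ((↑(graphEdge f) ∩ ↑B : Set (α × β))).ncard =
      (Finset.univ.filter fun i => (i, f i) ∈ B).card := by
  have hinj : Function.Injective fun i => (i, f i) := fun _ _ h => congrArg Prod.fst h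
  rw [← Finset.card_image_of_injective _ hinj, ← Set.ncard_coe_finset]
  congr 1
  ext ⟨i, b⟩
  simp only [Set.mem_inter_iff, Finset.mem_coe, mem_graphEdge, Finset.mem_image,
    Finset.mem_filter, Finset.mem_univ, true_and, Prod.mk.injEq]
  constructor
  · rintro ⟨rfl, h⟩
    exact ⟨i, h, rfl, rfl⟩
  · rintro ⟨j, h, rfl, rfl⟩
    exact ⟨rfl, h⟩

/-- The edges are the graphs of functions with at most `k` nonzero values. -/
def smallSupportEdges (r k n : ℕ) : Finset (Finset (Fin r × Fin (n + 1))) :=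
  (Finset.univ.filter fun f : Fin r → Fin (n + 1) =>
    (Finset.univ.filter fun i => f i ≠ 0).card ≤ k).image graphEdge

theorem mem_smallSupportEdges {r k n : ℕ} {e : Finset (Fin r × Fin (n + 1))} :
    e ∈ smallSupportEdges r k n ↔
      ∃ f : Fin r → Fin (n + 1),
        (Finset.univ.filter fun i => f i ≠ 0).card ≤ k ∧ graphEdge f = e := by
  simp [smallSupportEdges]

theorem isRPartite_smallSupportEdges (r k n : ℕ) :
    IsRPartite r Prod.fst (smallSupportEdges r k n) := by
  intro e he j
  obtain ⟨f, -, rfl⟩ := mem_smallSupportEdges.1 he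
  rw [Finset.card_eq_one]
  refine ⟨(j, f j), ?_⟩
  ext ⟨i, b⟩
  simp only [Finset.mem_filter, mem_graphEdge, Finset.mem_singleton, Prod.mk.injEq]
  constructor
  · rintro ⟨rfl, rfl⟩
    exact ⟨rfl, rfl⟩
  · rintro ⟨rfl, rfl⟩
    exact ⟨rfl, rfl⟩

theorem intersectingGe_smallSupportEdges {r k t : ℕ} (n : ℕ) (h : 2 * k + t ≤ r) :
    IntersectingGe t (smallSupportEdges r k n) := by
  intro e he e' he'
  obtain ⟨f, hf, rfl⟩ := mem_smallSupportEdges.1 he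
  obtain ⟨g, hg, rfl⟩ := mem_smallSupportEdges.1 he'
  rw [ncard_graphEdge_inter]
  simp only [mem_graphEdge]
  have hsub : (Finset.univ : Finset (Fin r)) ⊆
      (Finset.univ.filter fun i => g i = f i) ∪
        ((Finset.univ.filter fun i => f i ≠ 0) ∪ Finset.univ.filter fun i => g i ≠ 0) := by
    intro i _
    simp only [Finset.mem_union, Finset.mem_filter, Finset.mem_univ, true_and]
    by_cases hfi : f i = 0
    · by_cases hgi : g i = 0
      · exact Or.inl (hgi.trans hfi.symm)
      · exact Or.inr (Or.inr hgi)
    · exact Or.inr (Or.inl hfi)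
  have hcard := Finset.card_le_card hsub
  rw [Finset.card_univ, Fintype.card_fin] at hcard
  have h₁ := hcard.trans (Finset.card_union_le _ _)
  have h₂ := Finset.card_union_le (Finset.univ.filter fun i => f i ≠ 0)
    (Finset.univ.filter fun i => g i ≠ 0)
  omega

theorem isSCover_univ_smallSupportEdges {r s : ℕ} (k n : ℕ) (h : s ≤ r) :
    IsSCover s (smallSupportEdges r k n) Finset.univ := by
  intro e he
  obtain ⟨f, -, rfl⟩ := mem_smallSupportEdges.1 he
  rw [ncard_graphEdge_inter]
  simpa using h

/-- Any `s`-cover of the small-support edges has at least `k + s` vertices: otherwise an edge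
can leave it by changing up to `k` zero coordinates to values that the cover misses. -/
theorem le_card_of_isSCover_smallSupportEdges {r k s n : ℕ} (hs : 1 ≤ s) (hn : k + s ≤ n)
    {B : Finset (Fin r × Fin (n + 1))} (hB : IsSCover s (smallSupportEdges r k n) B) :
    k + s ≤ B.card := by
  by_contra! hlt
  have hfresh : ∀ i : Fin r, ∃ j : Fin (n + 1), (i, j) ∉ B := by
    intro i
    by_contra! hall
    have hle : (Finset.univ : Finset (Fin (n + 1))).card ≤ B.card :=
      Finset.card_le_card_of_injOn (fun j => (i, j)) (fun j _ => hall j)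
        (fun _ _ _ _ h => congrArg Prod.snd h)
    rw [Finset.card_univ, Fintype.card_fin] at hle
    omega
  choose g hg using hfresh
  set A : Finset (Fin r) := Finset.univ.filter fun i => (i, 0) ∈ B with hA
  have hAB : A.card ≤ B.card :=
    Finset.card_le_card_of_injOn (fun i => (i, 0)) (fun i hi => by simpa [hA] using hi)
      (fun _ _ _ _ h => congrArg Prod.fst h)
  obtain ⟨S, hSA, hS⟩ := Finset.exists_subset_card_eq (min_le_right k A.card)
  let f : Fin r → Fin (n + 1) := fun i => if i ∈ S then g i else 0
  have hsupp : (Finset.univ.filter fun i => f i ≠ 0) ⊆ S := by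
    intro i hi
    by_contra hiS
    simp [f, hiS] at hi
  have hf : graphEdge f ∈ smallSupportEdges r k n :=
    mem_smallSupportEdges.2
      ⟨f, (Finset.card_le_card hsupp).trans (hS.le.trans (min_le_left _ _)), rfl⟩
  have hcover := hB _ hf
  rw [ncard_graphEdge_inter] at hcover
  have hmeet : (Finset.univ.filter fun i => (i, f i) ∈ B) ⊆ A \ S := by
    intro i hi
    by_cases hiS : i ∈ S
    · simp [f, hiS, hg] at hi
    · simpa [f, hiS, hA] using hi
  have hle := Finset.card_le_card hmeet
  rw [Finset.card_sdiff_of_subset hSA] at hle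
  omega

/-- **Proposition 3.9** (lower bound): for all `1 ≤ s ≤ t ≤ r` there is an
`(r,t)`-graph `H` with `τ_s(H) ≥ ⌊(r - t)/2⌋ + s`. -/
theorem exists_rt_graph_large_sCover (r t s : ℕ)
    (hs : 1 ≤ s) (hst : s ≤ t) (htr : t ≤ r) :
    ∃ (V : Type) (_ : Fintype V) (part : V → Fin r) (E : Finset (Finset V)),
      IsRPartite r part E ∧ IntersectingGe t E ∧
      (r - t) / 2 + s ≤ sCoverNumber s E := by
  refine ⟨Fin r × Fin ((r - t) / 2 + s + 1), inferInstance, Prod.fst,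
    smallSupportEdges r ((r - t) / 2) ((r - t) / 2 + s), isRPartite_smallSupportEdges _ _ _,
    intersectingGe_smallSupportEdges _ (by omega), ?_⟩
  refine le_csInf ⟨_, Finset.univ,
    isSCover_univ_smallSupportEdges _ _ (hst.trans htr), rfl⟩ ?_
  rintro m ⟨B, hB, rfl⟩
  exact le_card_of_isSCover_smallSupportEdges hs le_rfl hB
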